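/- If T : ℍ → ℍ is a bijection with d(T(P),T(Q)) = d(P,Q) for all P,Q ∈ ℍ and T(O) = O, then there exists θ ∈ ℝ such that either T(z;t) = (e^{iθ} z; t) for all (z;t) ∈ ℍ, or T(z;t) = (e^{iθ} z̄; −t) for all (z;t) ∈ ℍ; consequently every isometry of (ℍ,d) is the composition of a left translation, a rotation R_θ : (z;t) ↦ (e^{iθ}z; t), and possibly the map J : (z;t) ↦ (z̄; −t). -/

import Mathlib

noncomputable section

open MeasureTheory

/-- Points of the Heisenberg group `ℍ`, identified with `ℝ³ ≅ ℂ × ℝ`: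
`(x, y, t)` corresponds to `(z ; t)` with `z = x + iy`. -/
abbrev H : Type := ℝ × ℝ × ℝ

/-- The Heisenberg group law
`(x,y,t)·(x',y',t') = (x+x', y+y', t+t'+2(x'y − xy'))`. -/
def Hmul (p q : H) : H :=
  (p.1 + q.1, p.2.1 + q.2.1, p.2.2 + q.2.2 + 2 * (q.1 * p.2.1 - p.1 * q.2.1))

/-- The Heisenberg group inverse. -/
def Hinv (p : H) : H := (-p.1, -p.2.1, -p.2.2)

/-- The identity `O = (0,0,0)`. -/
def HO : H := (0, 0, 0)

/-- The control (Carnot–Carathéodory) distance: the infimum of the lengths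
`∫₀¹ √(a(s)² + b(s)²) ds` of horizontal Lipschitz curves `γ` joining `P` to `Q`,
i.e. curves satisfying a.e. `γ' = a·X(γ) + b·Y(γ)` where `X = ∂ₓ + 2y∂_t` and
`Y = ∂_y − 2x∂_t`. -/
def dH (P Q : H) : ℝ :=
  sInf { L : ℝ | ∃ (γ : ℝ → H) (a b : ℝ → ℝ) (K : NNReal),
    LipschitzWith K γ ∧ γ 0 = P ∧ γ 1 = Q ∧
    (∀ᵐ s ∂volume, s ∈ Set.Icc (0:ℝ) 1 →
      HasDerivAt γ (a s, b s, 2 * (γ s).2.1 * a s - 2 * (γ s).1 * b s) s) ∧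
    IntervalIntegrable (fun s => Real.sqrt (a s ^ 2 + b s ^ 2)) volume 0 1 ∧
    L = ∫ s in (0:ℝ)..1, Real.sqrt (a s ^ 2 + b s ^ 2) }

/-- `γ : ℝ → ℍ` is a `(1+ε)`-quasigeodesic. -/
def IsQuasiGeodesic (ε : ℝ) (γ : ℝ → H) : Prop :=
  ∀ s s' : ℝ, (1 + ε)⁻¹ * |s - s'| ≤ dH (γ s) (γ s') ∧
    dH (γ s) (γ s') ≤ (1 + ε) * |s - s'|

/-- `f : ℍ → ℍ` is `(1+ε)`-biLipschitz for the control distance. -/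
def IsBiLip (ε : ℝ) (f : H → H) : Prop :=
  ∀ P Q : H, (1 + ε)⁻¹ * dH P Q ≤ dH (f P) (f Q) ∧ dH (f P) (f Q) ≤ (1 + ε) * dH P Q

/-- `(a,b)` is the horizontal speed of `γ`: a.e. `γ'(s) = a(s)X(γ(s)) + b(s)Y(γ(s))`. -/
def HasHorizSpeed (γ : ℝ → H) (a b : ℝ → ℝ) : Prop :=
  ∀ᵐ s ∂volume, HasDerivAt γ (a s, b s, 2 * (γ s).2.1 * a s - 2 * (γ s).1 * b s) s

/-- The rotation `R_θ : (z;t) ↦ (e^{iθ}z; t)`. -/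
def Hrot (θ : ℝ) (p : H) : H :=
  (Real.cos θ * p.1 - Real.sin θ * p.2.1, Real.sin θ * p.1 + Real.cos θ * p.2.1, p.2.2)

/-- The map `J : (z;t) ↦ (z̄; −t)`. -/
def HJ (p : H) : H := (p.1, -p.2.1, -p.2.2)


def Adm (P Q : H) (L : ℝ) : Prop := ∃ (γ : ℝ → H) (a b : ℝ → ℝ) (K : NNReal),
    LipschitzWith K γ ∧ γ 0 = P ∧ γ 1 = Q ∧
    (∀ᵐ s ∂volume, s ∈ Set.Icc (0:ℝ) 1 →
      HasDerivAt γ (a s, b s, 2 * (γ s).2.1 * a s - 2 * (γ s).1 * b s) s) ∧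
    IntervalIntegrable (fun s => Real.sqrt (a s ^ 2 + b s ^ 2)) volume 0 1 ∧
    L = ∫ s in (0:ℝ)..1, Real.sqrt (a s ^ 2 + b s ^ 2)

theorem dH_eq (P Q : H) : dH P Q = sInf {L | Adm P Q L} := rfl

theorem Adm.nonneg {P Q : H} {L : ℝ} (h : Adm P Q L) : 0 ≤ L := by
  obtain ⟨γ, a, b, K, -, -, -, -, -, rfl⟩ := h
  exact intervalIntegral.integral_nonneg (by norm_num) (fun s _ => Real.sqrt_nonneg _)

theorem Adm.le {P Q : H} {L : ℝ} (h : Adm P Q L) : dH P Q ≤ L :=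
  csInf_le ⟨0, fun _ h => Adm.nonneg h⟩ h

/-- the linear part -/
def simLin (p q : ℝ) (A : H) : H →ₗ[ℝ] H where
  toFun P := (p * P.1 - q * P.2.1, q * P.1 + p * P.2.1,
    (p^2+q^2) * P.2.2 + 2 * ((p * P.1 - q * P.2.1) * A.2.1 - A.1 * (q * P.1 + p * P.2.1)))
  map_add' P Q := by ext <;> simp <;> ring
  map_smul' c P := by ext <;> simp <;> ring

def sim (p q : ℝ) (A : H) (P : H) : H :=
  Hmul A (p * P.1 - q * P.2.1, q * P.1 + p * P.2.1, (p^2+q^2) * P.2.2)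

theorem sim_eq (p q : ℝ) (A P : H) :
    sim p q A P = A + LinearMap.toContinuousLinearMap (simLin p q A) P := by
  ext <;> simp [sim, simLin, Hmul] <;> ring

theorem Adm.sim {P Q : H} {L : ℝ} (h : Adm P Q L) (p q : ℝ) (A : H) :
    Adm (sim p q A P) (sim p q A Q) (Real.sqrt (p^2+q^2) * L) := by
  obtain ⟨γ, a, b, K, hK, h0, h1, hd, hi, rfl⟩ := h
  have key : ∀ s, Real.sqrt ((p * a s - q * b s)^2 + (q * a s + p * b s)^2)
      = Real.sqrt (p^2+q^2) * Real.sqrt (a s ^2 + b s ^2) := by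
    intro s
    rw [← Real.sqrt_mul (by positivity)]
    congr 1; ring
  refine ⟨fun s => _root_.sim p q A (γ s), fun s => p * a s - q * b s, fun s => q * a s + p * b s,
    ‖LinearMap.toContinuousLinearMap (simLin p q A)‖₊ * K, ?_, by simp only [h0],
    by simp only [h1], ?_, ?_, ?_⟩
  · have h2 : (fun s => _root_.sim p q A (γ s))
        = (fun P => A + P) ∘ (LinearMap.toContinuousLinearMap (simLin p q A)) ∘ γ := by
      funext s; simp only [sim_eq, Function.comp]
    rw [h2]
    have := (isometry_add_left A).lipschitz.comp
      ((LinearMap.toContinuousLinearMap (simLin p q A)).lipschitz.comp hK)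
    rwa [one_mul] at this
  · filter_upwards [hd] with s hs hs1
    have h3 := ((LinearMap.toContinuousLinearMap (simLin p q A)).hasFDerivAt.comp_hasDerivAt s
      (hs hs1)).const_add A
    have h2 : (fun s => _root_.sim p q A (γ s))
        = (fun s => A + ((LinearMap.toContinuousLinearMap (simLin p q A)) ∘ γ) s) := by
      funext s; simp only [sim_eq, Function.comp]
    rw [h2]
    convert! h3 using 1
    ext <;> simp [_root_.sim, simLin, Hmul] <;> ring
  · simp only [key]; exact hi.const_mul _
  · simp only [key]; rw [intervalIntegral.integral_const_mul]

theorem Adm.seg (P : H) (u v : ℝ) : Adm P (Hmul P (u, v, 0)) (Real.sqrt (u^2+v^2)) := by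
  have hd : ∀ s : ℝ, HasDerivAt (fun s : ℝ => P + s • ((u, v, 2 * (u * P.2.1 - P.1 * v)) : H))
      ((u, v, 2 * (u * P.2.1 - P.1 * v)) : H) s := by
    intro s
    simpa using ((hasDerivAt_id s).smul_const ((u, v, 2 * (u * P.2.1 - P.1 * v)) : H)).const_add P
  refine ⟨fun s => P + s • ((u, v, 2 * (u * P.2.1 - P.1 * v)) : H), fun _ => u, fun _ => v,
    ‖((u, v, 2 * (u * P.2.1 - P.1 * v)) : H)‖₊, ?_, ?_, ?_, ?_, ?_, ?_⟩
  · apply lipschitzWith_of_nnnorm_deriv_le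
    · intro s; exact (hd s).differentiableAt
    · intro s; rw [(hd s).deriv]
  · simp
  · ext <;> simp [Hmul]
  · refine Filter.Eventually.of_forall fun s _ => ?_
    convert! hd s using 1
    ext <;> simp <;> ring
  · simp
  · simp

theorem Adm.trans {P Q R : H} {L M : ℝ} (h : Adm P Q L) (h' : Adm Q R M) : Adm P R (L + M) := by
  obtain ⟨γ, a, b, K, hK, h0, h1, hd, hi, rfl⟩ := h
  obtain ⟨γ', a', b', K', hK', h0', h1', hd', hi', rfl⟩ := h'
  set f : ℝ → ℝ := fun s => Real.sqrt (a s ^2 + b s ^2) with hf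
  set g : ℝ → ℝ := fun s => Real.sqrt (a' s ^2 + b' s ^2) with hg
  set F : ℝ → H := fun s => γ (min (2 * s) 1) + γ' (max (2 * s - 1) 0) - Q with hF
  set c : ℝ → ℝ := fun s => if s < 1/2 then 2 * a (2 * s) else 2 * a' (2 * s - 1) with hc
  set d : ℝ → ℝ := fun s => if s < 1/2 then 2 * b (2 * s) else 2 * b' (2 * s - 1) with hdd
  have hF1 : ∀ s, s ≤ 1/2 → F s = γ (2 * s) := by
    intro s hs
    simp only [hF]
    rw [min_eq_left (by linarith), max_eq_right (by linarith), h0']; abel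
  have hF2 : ∀ s, 1/2 ≤ s → F s = γ' (2 * s - 1) := by
    intro s hs
    simp only [hF]
    rw [min_eq_right (by linarith), max_eq_left (by linarith), h1]; abel
  have s1 : ∀ s, s < 1/2 → Real.sqrt (c s ^2 + d s ^2) = 2 * f (2 * s) := by
    intro s hs
    simp only [hc, hdd, hf, if_pos hs]
    rw [← Real.sqrt_sq (show (0:ℝ) ≤ 2 by norm_num), ← Real.sqrt_mul (by positivity),
      Real.sqrt_sq (by norm_num)]
    congr 1; ring
  have s2 : ∀ s, 1/2 ≤ s → Real.sqrt (c s ^2 + d s ^2) = 2 * g (2 * s - 1) := by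
    intro s hs
    simp only [hc, hdd, hg, if_neg (not_lt.2 hs)]
    rw [← Real.sqrt_sq (show (0:ℝ) ≤ 2 by norm_num), ← Real.sqrt_mul (by positivity),
      Real.sqrt_sq (by norm_num)]
    congr 1; ring
  have i1 : IntervalIntegrable (fun s => 2 * f (2 * s)) volume 0 (1/2) := by
    have := (hi.comp_mul_left (c := 2)).const_mul 2
    simpa using this
  have i2 : IntervalIntegrable (fun s => 2 * g (2 * s - 1)) volume (1/2) 1 := by
    have := ((hi'.comp_sub_right 1).comp_mul_left (c := 2)).const_mul 2
    norm_num at this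
    exact this
  have e1 : Set.EqOn (fun s => 2 * f (2 * s)) (fun s => Real.sqrt (c s ^2 + d s ^2))
      (Set.uIoo 0 (1/2)) := by
    intro s hs
    rw [Set.uIoo_of_le (by norm_num)] at hs
    exact (s1 s hs.2).symm
  have e2 : Set.EqOn (fun s => 2 * g (2 * s - 1)) (fun s => Real.sqrt (c s ^2 + d s ^2))
      (Set.uIoo (1/2) 1) := by
    intro s hs
    rw [Set.uIoo_of_le (by norm_num)] at hs
    exact (s2 s hs.1.le).symm
  have j1 := i1.congr_uIoo e1
  have j2 := i2.congr_uIoo e2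
  have q1 : ∀ᵐ s ∂volume, 2 * s ∈ Set.Icc (0:ℝ) 1 → HasDerivAt γ (a (2*s), b (2*s), 2 * (γ (2*s)).2.1 * a (2*s) - 2 * (γ (2*s)).1 * b (2*s)) (2*s) := by
    have : Measure.QuasiMeasurePreserving (fun s : ℝ => 2 * s) volume volume := by
      refine ⟨by fun_prop, ?_⟩
      rw [Real.map_volume_mul_left (by norm_num)]
      exact Measure.smul_absolutelyContinuous
    exact this.ae hd
  have q2 : ∀ᵐ s ∂volume, 2 * s - 1 ∈ Set.Icc (0:ℝ) 1 → HasDerivAt γ' (a' (2*s-1), b' (2*s-1), 2 * (γ' (2*s-1)).2.1 * a' (2*s-1) - 2 * (γ' (2*s-1)).1 * b' (2*s-1)) (2*s-1) := by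
    have : Measure.QuasiMeasurePreserving (fun s : ℝ => 2 * s) volume volume := by
      refine ⟨by fun_prop, ?_⟩
      rw [Real.map_volume_mul_left (by norm_num)]
      exact Measure.smul_absolutelyContinuous
    exact (((measurePreserving_sub_right volume (1:ℝ)).quasiMeasurePreserving).comp this).ae hd'
  refine ⟨F, c, d, K * (1 * 2) + K' * (1 * 2), ?_, ?_, ?_, ?_, ?_, ?_⟩
  · have m2 : LipschitzWith 2 (fun s : ℝ => 2 * s) := by
      apply LipschitzWith.of_dist_le_mul
      intro x y
      rw [Real.dist_eq, Real.dist_eq, ← mul_sub, abs_mul]; simp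
    have m3 : LipschitzWith 2 (fun s : ℝ => 2 * s - 1) := by
      apply LipschitzWith.of_dist_le_mul
      intro x y
      rw [Real.dist_eq, Real.dist_eq, sub_sub_sub_cancel_right, ← mul_sub, abs_mul]; simp
    have l1 : LipschitzWith (1*2) (fun s : ℝ => min (2 * s) 1) := by
      simpa using m2.min_const 1
    have l2 : LipschitzWith (1*2) (fun s : ℝ => max (2 * s - 1) 0) := by
      simpa using m3.max_const 0
    have := ((hK.comp l1).add (hK'.comp l2)).sub (LipschitzWith.const Q)
    simpa using this
  · rw [hF1 _ (by norm_num)]; simpa using h0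
  · rw [hF2 _ (by norm_num)]; norm_num; exact h1'
  · have hne : ∀ᵐ s : ℝ ∂volume, s ≠ 1/2 := by
      simp [ae_iff]
    filter_upwards [q1, q2, hne] with s hs1 hs2 hs3 hs
    rcases lt_or_gt_of_ne hs3 with h | h
    · have := (hs1 ⟨by linarith [hs.1], by linarith⟩).scomp s ((hasDerivAt_id s).const_mul 2)
      have h5 : F =ᶠ[nhds s] γ ∘ fun y => 2 * id y := by
        filter_upwards [Iio_mem_nhds h] with y hy
        exact hF1 y (le_of_lt hy)
      refine HasDerivAt.congr_of_eventuallyEq ?_ h5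
      convert! this using 1
      rw [hF1 s h.le]
      ext <;> simp only [hc, hdd, if_pos h] <;> simp <;> ring
    · have := (hs2 ⟨by linarith [hs.1], by linarith [hs.2]⟩).scomp s
        (((hasDerivAt_id s).const_mul 2).sub_const 1)
      have h5 : F =ᶠ[nhds s] γ' ∘ fun y => 2 * id y - 1 := by
        filter_upwards [Ioi_mem_nhds h] with y hy
        exact hF2 y (le_of_lt hy)
      refine HasDerivAt.congr_of_eventuallyEq ?_ h5
      convert! this using 1
      rw [hF2 s h.le]
      ext <;> simp only [hc, hdd, if_neg (not_lt.2 h.le)] <;> simp <;> ring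
  · exact j1.trans j2
  · rw [← intervalIntegral.integral_add_adjacent_intervals j1 j2,
      ← intervalIntegral.integral_congr_uIoo e1, ← intervalIntegral.integral_congr_uIoo e2]
    rw [intervalIntegral.integral_const_mul, intervalIntegral.integral_const_mul,
      intervalIntegral.integral_comp_mul_left f (by norm_num : (2:ℝ) ≠ 0),
      intervalIntegral.integral_comp_mul_sub g (by norm_num : (2:ℝ) ≠ 0)]
    norm_num
    ring

theorem Adm.vert (P : H) (t : ℝ) : ∃ L, Adm P (Hmul P (0, 0, t)) L ∧ L ≤ 2 * Real.sqrt |t| := by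
  obtain ⟨a, b, hab, ha, hb⟩ : ∃ a b : ℝ, -4 * a * b = t ∧ |a| = Real.sqrt |t| / 2 ∧
      |b| = Real.sqrt |t| / 2 := by
    have h := Real.mul_self_sqrt (abs_nonneg t)
    have h0 := Real.sqrt_nonneg |t|
    rcases le_total 0 t with ht | ht
    · rw [abs_of_nonneg ht] at *
      refine ⟨Real.sqrt t / 2, - (Real.sqrt t / 2), by linarith, ?_, ?_⟩
      · rw [abs_of_nonneg (by positivity)]
      · rw [abs_neg, abs_of_nonneg (by positivity)]
    · rw [abs_of_nonpos ht] at *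
      refine ⟨Real.sqrt (-t) / 2, (Real.sqrt (-t) / 2), by linarith, ?_, ?_⟩ <;>
      · rw [abs_of_nonneg (by positivity)]
  have := (((Adm.seg P a 0).trans (Adm.seg _ 0 b)).trans (Adm.seg _ (-a) 0)).trans
    (Adm.seg _ 0 (-b))
  refine ⟨_, ?_, le_refl _⟩
  convert! this using 1
  · subst hab
    ext <;> simp [Hmul]; ring
  · simp [Real.sqrt_sq_eq_abs, ha, hb]; ring

theorem Hmul_assoc' (A B C : H) : Hmul (Hmul A B) C = Hmul A (Hmul B C) := by
  ext <;> simp [Hmul] <;> ring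

theorem Hinv_mul (A : H) : Hmul (Hinv A) A = HO := by
  ext <;> simp [Hmul, Hinv, HO] <;> ring

theorem Hmul_inv (A : H) : Hmul A (Hinv A) = HO := by
  ext <;> simp [Hmul, Hinv, HO] <;> ring

theorem HO_mul (A : H) : Hmul HO A = A := by
  ext <;> simp [Hmul, HO]

theorem Hmul_HO (A : H) : Hmul A HO = A := by
  ext <;> simp [Hmul, HO]

theorem Hmul_cancel (A B : H) : Hmul A (Hmul (Hinv A) B) = B := by
  rw [← Hmul_assoc', Hmul_inv, HO_mul]

theorem Hmul_cancel' (A B : H) : Hmul (Hinv A) (Hmul A B) = B := by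
  rw [← Hmul_assoc', Hinv_mul, HO_mul]

theorem Adm.exists (P Q : H) : ∃ L, Adm P Q L := by
  set W := Hmul (Hinv P) Q with hW
  obtain ⟨L, hL, -⟩ := Adm.vert (Hmul P (W.1, W.2.1, 0)) W.2.2
  refine ⟨Real.sqrt (W.1^2+W.2.1^2) + L, ?_⟩
  convert! (Adm.seg P W.1 W.2.1).trans hL using 1
  rw [Hmul_assoc']
  conv_lhs => rw [← Hmul_cancel P Q, ← hW]
  congr 1
  ext <;> simp [Hmul]

theorem le_dH {P Q : H} {c : ℝ} (h : ∀ L, Adm P Q L → c ≤ L) : c ≤ dH P Q :=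
  le_csInf (Adm.exists P Q) h

theorem exists_lt (P Q : H) {ε : ℝ} (hε : 0 < ε) : ∃ L, Adm P Q L ∧ L < dH P Q + ε := by
  obtain ⟨L, hL, h⟩ := exists_lt_of_csInf_lt (Adm.exists P Q) (show sInf {L | Adm P Q L} < dH P Q + ε by
    rw [← dH_eq]; linarith)
  exact ⟨L, hL, h⟩

theorem dH_nonneg (P Q : H) : 0 ≤ dH P Q := le_dH fun _ h => h.nonneg

theorem dH_tri (P Q R : H) : dH P R ≤ dH P Q + dH Q R := by
  refine le_of_forall_pos_le_add fun ε hε => ?_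
  obtain ⟨L, hL, h⟩ := exists_lt P Q (half_pos hε)
  obtain ⟨M, hM, h'⟩ := exists_lt Q R (half_pos hε)
  linarith [(hL.trans hM).le]

theorem dH_sim (p q : ℝ) (A P Q : H) :
    dH (sim p q A P) (sim p q A Q) ≤ Real.sqrt (p^2+q^2) * dH P Q := by
  refine le_of_forall_pos_le_add fun ε hε => ?_
  have h0 := Real.sqrt_nonneg (p^2+q^2)
  obtain ⟨L, hL, h⟩ := exists_lt P Q (ε := ε / (Real.sqrt (p^2+q^2) + 1)) (by positivity)
  have h1 := (hL.sim p q A).le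
  have h2 : Real.sqrt (p^2+q^2) * (ε / (Real.sqrt (p^2+q^2) + 1)) ≤ ε := by
    rw [mul_div_assoc', div_le_iff₀ (by positivity)]
    nlinarith
  nlinarith

theorem dH_left_le (A P Q : H) : dH (Hmul A P) (Hmul A Q) ≤ dH P Q := by
  have := dH_sim 1 0 A P Q
  simpa [sim] using this

theorem dH_left (A P Q : H) : dH (Hmul A P) (Hmul A Q) = dH P Q := by
  refine le_antisymm (dH_left_le A P Q) ?_
  have := dH_left_le (Hinv A) (Hmul A P) (Hmul A Q)
  rwa [Hmul_cancel', Hmul_cancel'] at this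

theorem dH_seg (P : H) (u v : ℝ) : dH P (Hmul P (u, v, 0)) ≤ Real.sqrt (u^2+v^2) :=
  (Adm.seg P u v).le

theorem dH_vert (P : H) (t : ℝ) : dH P (Hmul P (0, 0, t)) ≤ 2 * Real.sqrt |t| := by
  obtain ⟨L, hL, h⟩ := Adm.vert P t
  exact hL.le.trans h

theorem dH_le (x y t : ℝ) : dH HO (x, y, t) ≤ Real.sqrt (x^2+y^2) + 2 * Real.sqrt |t| := by
  have h1 := dH_seg HO x y
  have h2 := dH_vert (Hmul HO (x, y, 0)) t
  have h3 := dH_tri HO (Hmul HO (x, y, 0)) (Hmul (Hmul HO (x, y, 0)) (0, 0, t))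
  have : Hmul (Hmul HO (x, y, 0)) (0, 0, t) = (x, y, t) := by ext <;> simp [Hmul, HO]
  rw [this] at h2 h3
  linarith

theorem Adm.lower {P Q : H} {L : ℝ} (h : Adm P Q L) {ε : ℝ} (hε : 0 < ε) :
    Real.sqrt (Real.sqrt ((Q.1^2+Q.2.1^2)^2 + Q.2.2^2 + ε))
     - Real.sqrt (Real.sqrt ((P.1^2+P.2.1^2)^2 + P.2.2^2 + ε)) ≤ L := by
  obtain ⟨γ, a, b, K, hK, rfl, rfl, hd, hi, rfl⟩ := h
  set F : H → ℝ := fun Q => Real.sqrt (Real.sqrt ((Q.1^2+Q.2.1^2)^2 + Q.2.2^2 + ε)) with hF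
  have hFc : ContDiff ℝ 1 F := by
    rw [contDiff_iff_contDiffAt]
    intro x
    have h1 : (0:ℝ) < (x.1^2+x.2.1^2)^2 + x.2.2^2 + ε := by positivity
    refine ContDiffAt.sqrt (ContDiffAt.sqrt ?_ h1.ne') (Real.sqrt_pos.2 h1).ne'
    fun_prop
  have hac : AbsolutelyContinuousOnInterval (F ∘ γ) 0 1 := by
    have h1 : LocallyLipschitz (F ∘ γ) := hFc.locallyLipschitz.comp hK.locallyLipschitz
    obtain ⟨C, hC⟩ := LocallyLipschitzOn.exists_lipschitzOnWith_of_compact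
      (s := Set.uIcc (0:ℝ) 1) isCompact_uIcc h1.locallyLipschitzOn
    exact hC.absolutelyContinuousOnInterval
  have := hac.integral_deriv_eq_sub
  change F (γ 1) - F (γ 0) ≤ _
  simp only [Function.comp] at this
  rw [← this]
  refine intervalIntegral.integral_mono_ae_restrict (by norm_num) hac.intervalIntegrable_deriv hi ?_
  rw [Filter.EventuallyLE, ae_restrict_iff' measurableSet_Icc]
  filter_upwards [hd] with s hs hs1
  have h := hs hs1
  have hx : HasDerivAt (fun s => (γ s).1) (a s) s := h.fst
  have hy : HasDerivAt (fun s => (γ s).2.1) (b s) s := h.snd.fst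
  have ht : HasDerivAt (fun s => (γ s).2.2) (2 * (γ s).2.1 * a s - 2 * (γ s).1 * b s) s := h.snd.snd
  have h1 : (0:ℝ) < ((γ s).1^2+(γ s).2.1^2)^2 + (γ s).2.2^2 + ε := by positivity
  have hG := (((((hx.pow 2).add (hy.pow 2)).pow 2).add (ht.pow 2)).add_const ε).sqrt
    (by simpa using h1.ne')
  have hG2 := hG.sqrt (by simpa using (Real.sqrt_pos.2 h1).ne')
  have e : F ∘ γ = _ := rfl
  have hG3 : deriv (F ∘ γ) s = _ := hG2.deriv
  rw [hG3]
  simp only [Pi.add_apply, Pi.pow_apply]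
  generalize (γ s).1 = x at *
  generalize (γ s).2.1 = y at *
  generalize (γ s).2.2 = t at *
  generalize a s = p
  generalize b s = q
  set N := (x^2+y^2)^2+t^2+ε with hN
  set S := Real.sqrt N with hS
  have hS0 : 0 < S := Real.sqrt_pos.2 h1
  have hS2 : S^2 = N := Real.sq_sqrt h1.le
  set R := Real.sqrt S with hR
  have hR0 : 0 < R := Real.sqrt_pos.2 hS0
  have hR2 : R^2 = S := Real.sq_sqrt hS0.le
  apply Real.le_sqrt_of_sq_le
  rw [div_div, div_pow, div_le_iff₀ (by positivity)]
  push_cast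
  have e1 : (2 * S * (2 * R))^2 = 16 * (S * N) := by rw [← hS2]; linear_combination 16 * S^2 * hR2
  rw [e1]
  have z : x^2+y^2 ≤ S := by
    apply Real.le_sqrt_of_sq_le
    nlinarith [sq_nonneg t]
  have cs : (p * (x * (x^2+y^2) + y * t) + q * (y*(x^2+y^2) - x * t))^2 ≤
     (p^2+q^2) * ((x^2+y^2) * ((x^2+y^2)^2+t^2)) := by
    nlinarith [sq_nonneg (p * (y*(x^2+y^2) - x * t) - q * (x * (x^2+y^2) + y * t))]
  have hb : (x^2+y^2) * ((x^2+y^2)^2+t^2) ≤ S * N := by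
    apply mul_le_mul z _ (by positivity) hS0.le
    linarith
  have hb' := mul_le_mul_of_nonneg_left hb (show 0 ≤ p^2+q^2 by positivity)
  calc _ = 16 * (p * (x * (x^2+y^2) + y * t) + q * (y*(x^2+y^2) - x * t))^2 := by ring
    _ ≤ _ := by linarith

theorem dH_ge (x y t : ℝ) : Real.sqrt (Real.sqrt ((x^2+y^2)^2 + t^2)) ≤ dH HO (x, y, t) := by
  refine le_dH fun L hL => ?_
  have h1 : ∀ ε > 0, Real.sqrt (Real.sqrt ((x^2+y^2)^2 + t^2 + ε)) - Real.sqrt (Real.sqrt ε) ≤ L := by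
    intro ε hε
    simpa [HO] using hL.lower hε
  have hc : Continuous fun ε => Real.sqrt (Real.sqrt ((x^2+y^2)^2 + t^2 + ε)) - Real.sqrt (Real.sqrt ε) := by
    fun_prop
  have h2 := (hc.tendsto 0).mono_left (nhdsWithin_le_nhds (s := Set.Ioi 0))
  simp only [add_zero, Real.sqrt_zero, sub_zero] at h2
  exact le_of_tendsto h2 (by filter_upwards [self_mem_nhdsWithin] with ε hε using h1 ε hε)

theorem dH_ge' (x y t : ℝ) : Real.sqrt (x^2+y^2) ≤ dH HO (x, y, t) := by
  refine le_trans (Real.sqrt_le_sqrt (Real.le_sqrt_of_sq_le ?_)) (dH_ge x y t)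
  nlinarith [sq_nonneg t]

theorem dH_hor (x y : ℝ) : dH HO (x, y, 0) = Real.sqrt (x^2+y^2) := by
  refine le_antisymm ?_ (dH_ge' x y 0)
  have := dH_seg HO x y
  rwa [HO_mul] at this

theorem dH_strict (x y t : ℝ) (ht : t ≠ 0) : Real.sqrt (x^2+y^2) < dH HO (x, y, t) := by
  refine lt_of_lt_of_le (Real.sqrt_lt_sqrt (by positivity) (Real.lt_sqrt_of_sq_lt ?_)) (dH_ge x y t)
  have : 0 < t^2 := by positivity
  linarith

theorem dH_eq0 (P Q : H) : dH P Q = dH HO (Hmul (Hinv P) Q) := by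
  rw [← dH_left (Hinv P), Hinv_mul]

theorem dH_proj (P Q : H) : Real.sqrt ((Q.1-P.1)^2+(Q.2.1-P.2.1)^2) ≤ dH P Q := by
  rw [dH_eq0]
  refine le_trans (le_of_eq ?_) (dH_ge' _ _ _)
  simp only [Hmul, Hinv]
  congr 1; ring

theorem conj_le (w₁ w₂ s t : ℝ) (hw : 0 < w₁^2+w₂^2) :
    dH HO (w₁, w₂, s + t) ≤ dH HO (w₁, w₂, s) + |t| / (2 * Real.sqrt (w₁^2+w₂^2)) := by
  set r := Real.sqrt (w₁^2+w₂^2) with hr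
  have hr0 : 0 < r := Real.sqrt_pos.2 hw
  have hr2 : r^2 = w₁^2+w₂^2 := Real.sq_sqrt hw.le
  set k := t / (4 * r^2) with hk
  have ha : Real.sqrt ((-k * w₂)^2 + (k * w₁)^2) = |t| / (4 * r) := by
    rw [show (-k * w₂)^2 + (k * w₁)^2 = (k * r)^2 by
        linear_combination -k^2 * hr2,
      Real.sqrt_sq_eq_abs, hk, show t / (4 * r^2) * r = t / (4 * r) by field_simp, abs_div,
      abs_of_pos (show 0 < 4 * r by positivity)]
  have ha' : Real.sqrt ((k * w₂)^2 + (-k * w₁)^2) = |t| / (4 * r) := by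
    rw [← ha]; congr 1; ring
  have h1 := dH_seg HO (-k * w₂) (k * w₁)
  rw [HO_mul, ha] at h1
  have h2 := dH_left (-k * w₂, k * w₁, 0) HO (w₁, w₂, s)
  rw [Hmul_HO] at h2
  have h3 := dH_seg (Hmul (-k * w₂, k * w₁, 0) (w₁, w₂, s)) (k * w₂) (-k * w₁)
  rw [ha'] at h3
  have e : Hmul (Hmul (-k * w₂, k * w₁, 0) (w₁, w₂, s)) (k * w₂, -k * w₁, 0) = (w₁, w₂, s + t) := by
    have : 4 * k * (w₁^2+w₂^2) = t := by rw [← hr2, hk]; field_simp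
    ext
    · simp [Hmul]
    · simp [Hmul]
    · simp [Hmul]; linear_combination this
  rw [e] at h3
  have h4 := dH_tri HO (-k * w₂, k * w₁, 0) (w₁, w₂, s + t)
  have h5 := dH_tri (-k * w₂, k * w₁, 0) (Hmul (-k * w₂, k * w₁, 0) (w₁, w₂, s)) (w₁, w₂, s + t)
  have h6 : |t| / (2 * r) = |t| / (4 * r) + |t| / (4 * r) := by field_simp; ring
  linarith

theorem dil_le (w₁ w₂ s l : ℝ) (hl : 0 ≤ l) :
    dH HO (w₁, w₂, l^2 * s) ≤ l * dH HO (w₁, w₂, s) + |l - 1| * Real.sqrt (w₁^2+w₂^2) := by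
  have h1 := dH_sim l 0 HO HO (w₁, w₂, s)
  have e1 : sim l 0 HO HO = HO := by ext <;> simp [sim, Hmul, HO]
  have e2 : sim l 0 HO (w₁, w₂, s) = (l * w₁, l * w₂, l^2 * s) := by ext <;> simp [sim, Hmul, HO]
  rw [e1, e2, show l^2 + (0:ℝ)^2 = l^2 by ring, Real.sqrt_sq hl] at h1
  have h2 := dH_seg (l * w₁, l * w₂, l^2 * s) ((1-l) * w₁) ((1-l) * w₂)
  have e3 : Hmul (l * w₁, l * w₂, l^2 * s) ((1-l) * w₁, (1-l) * w₂, 0) = (w₁, w₂, l^2*s) := by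
    ext <;> simp [Hmul] <;> ring
  rw [e3, show ((1-l) * w₁)^2 + ((1-l) * w₂)^2 = (l-1)^2 * (w₁^2+w₂^2) by ring,
    Real.sqrt_mul (by positivity), Real.sqrt_sq_eq_abs] at h2
  linarith [dH_tri HO (l * w₁, l * w₂, l^2 * s) (w₁, w₂, l^2*s)]

theorem vert_small (t ε : ℝ) (hε : 0 < ε) : ∃ R₀ : ℝ, ∀ w₁ w₂ s, R₀ ≤ dH HO (w₁, w₂, s) →
    dH HO (w₁, w₂, s + t) ≤ dH HO (w₁, w₂, s) + ε := by
  set M := |t| / (2 * ε) + 1 with hM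
  have ht := abs_nonneg t
  have hM0 : 1 ≤ M := by have : 0 ≤ |t| / (2 * ε) := by positivity
                         linarith
  have hMt : |t| ≤ 2 * ε * M := by
    have : 2 * ε * M = |t| + 2 * ε := by rw [hM]; field_simp
    linarith
  set σ := 1 + |t| + |t| * (2 * M + 2) / ε with hσ
  have hσ1 : 1 + |t| ≤ σ := by
    have : 0 ≤ |t| * (2 * M + 2) / ε := by positivity
    linarith
  have hσ2 : |t| * (2 * M + 2) ≤ ε * σ := by
    have : ε * σ = ε * (1 + |t|) + |t| * (2 * M + 2) := by rw [hσ]; field_simp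
    have : 0 ≤ ε * (1 + |t|) := by positivity
    linarith
  refine ⟨M + 2 * σ, fun w₁ w₂ s hd => ?_⟩
  set r := Real.sqrt (w₁^2+w₂^2) with hr
  rcases le_or_gt M r with h | h
  · have hr0 : 0 < r := by linarith
    have := conj_le w₁ w₂ s t (Real.sqrt_pos.1 hr0)
    refine this.trans (add_le_add le_rfl ?_)
    rw [← hr, div_le_iff₀ (by positivity)]
    nlinarith
  · have hr0 : 0 ≤ r := Real.sqrt_nonneg _
    have h1 := dH_le w₁ w₂ s
    rw [← hr] at h1
    set q := Real.sqrt |s| with hq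
    have hqσ : σ ≤ q := by linarith
    have hq2 : q^2 = |s| := Real.sq_sqrt (abs_nonneg s)
    have hq1 : 1 ≤ q := by linarith
    have hs0 : 0 < |s| := by rw [← hq2]; positivity
    have hts : |t| ≤ |s| := by rw [← hq2]; nlinarith
    set u := t / s with hu
    have hsne : s ≠ 0 := abs_pos.1 hs0
    have hus : u * s = t := by rw [hu]; field_simp
    have hua : |u| * |s| = |t| := by rw [← abs_mul, hus]
    have hu1 : |u| ≤ 1 := by
      by_contra hc
      push Not at hc
      nlinarith
    have hu2 : 0 ≤ 1 + u := by linarith [neg_abs_le u]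
    set l := Real.sqrt (1 + u) with hl
    have hl0 : 0 ≤ l := Real.sqrt_nonneg _
    have hl2 : l^2 = 1 + u := Real.sq_sqrt hu2
    have hl1 : |l - 1| ≤ |u| := by
      have : u = (l - 1) * (l + 1) := by linarith
      rw [this, abs_mul, abs_of_nonneg (show 0 ≤ l + 1 by linarith)]
      nlinarith [abs_nonneg (l-1)]
    have h2 := dil_le w₁ w₂ s l hl0
    rw [← hr, show l^2 * s = s + t by rw [hl2]; linarith] at h2
    set D := dH HO (w₁, w₂, s)
    have hD : 0 ≤ D := dH_nonneg _ _
    have h3 : l * D ≤ D + |l - 1| * D := by nlinarith [le_abs_self (l-1)]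
    have h4 : |l - 1| * (D + r) ≤ |u| * (2 * M + 2 * q) := by
      apply mul_le_mul hl1 (by linarith) (by positivity) (abs_nonneg _)
    have h5 : |u| * (2 * M + 2 * q) ≤ |u| * ((2 * M + 2) * q) := by
      apply mul_le_mul_of_nonneg_left _ (abs_nonneg _)
      nlinarith
    have h6 : |u| * ((2 * M + 2) * q) ≤ ε := by
      have : (|u| * ((2 * M + 2) * q)) * q ≤ ε * q := by
        calc (|u| * ((2 * M + 2) * q)) * q = (|u| * |s|) * (2 * M + 2) := by rw [← hq2]; ring
          _ = |t| * (2 * M + 2) := by rw [hua]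
          _ ≤ ε * q := by nlinarith
      exact le_of_mul_le_mul_right this (by linarith)
    have h7 : |l - 1| * (D + r) = |l - 1| * D + |l - 1| * r := by ring
    linarith

theorem ext_hor (Q : H) (h : ∀ r, dH HO Q ≤ r → ∃ Q', dH HO Q' = r ∧ dH Q Q' = r - dH HO Q) :
    Q.2.2 = 0 := by
  obtain ⟨x, y, t⟩ := Q
  by_contra ht
  simp only at ht
  have h1 := dH_strict x y t ht
  set ρ := dH HO (x, y, t) with hρ
  obtain ⟨R₀, hR⟩ := vert_small t ((ρ - Real.sqrt (x^2+y^2)) / 2) (by linarith)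
  obtain ⟨Q', h2, h3⟩ := h (ρ + max R₀ 0) (by linarith [le_max_right R₀ 0])
  rw [dH_eq0] at h3
  obtain ⟨w₁, w₂, s⟩ : H := Hmul (Hinv (x, y, t)) Q'
  have h4 : Hmul (Hinv (x, y, 0)) Q' = Hmul (0, 0, t) (Hmul (Hinv (x, y, t)) Q') := by
    ext <;> simp [Hmul, Hinv]; ring
  have h5 := dH_tri HO (x, y, 0) Q'
  rw [dH_hor, dH_eq0 (x, y, 0), h4] at h5
  generalize hW : Hmul (Hinv (x, y, t)) Q' = W at *
  obtain ⟨w₁, w₂, s⟩ := W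
  have h6 : Hmul (0, 0, t) (w₁, w₂, s) = (w₁, w₂, s + t) := by
    ext <;> simp [Hmul]; ring
  rw [h6] at h5
  have h7 := hR w₁ w₂ s (by rw [h3]; linarith [le_max_left R₀ 0])
  linarith

theorem hor_ext (x y r : ℝ) (hr : dH HO (x, y, 0) ≤ r) :
    ∃ Q', dH HO Q' = r ∧ dH (x, y, 0) Q' = r - dH HO (x, y, 0) := by
  obtain ⟨c, s, hcs, hx, hy⟩ : ∃ c s : ℝ, c^2+s^2 = 1 ∧ x = Real.sqrt (x^2+y^2) * c ∧
      y = Real.sqrt (x^2+y^2) * s := by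
    have h2 : Real.sqrt (x^2+y^2)^2 = x^2+y^2 := Real.sq_sqrt (by positivity)
    rcases eq_or_ne (Real.sqrt (x^2+y^2)) 0 with h | h
    · rw [h] at h2
      refine ⟨1, 0, by norm_num, ?_, ?_⟩
      · nlinarith [sq_nonneg y]
      · nlinarith [sq_nonneg x]
    · refine ⟨x / Real.sqrt (x^2+y^2), y / Real.sqrt (x^2+y^2), ?_, ?_, ?_⟩
      · rw [div_pow, div_pow, h2, ← add_div, div_self]
        rw [← h2]; positivity
      · field_simp
      · field_simp
  rw [dH_hor] at *
  set m := Real.sqrt (x^2+y^2) with hm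
  have hm0 : 0 ≤ m := Real.sqrt_nonneg _
  refine ⟨(r * c, r * s, 0), ?_, ?_⟩
  · rw [dH_hor, show (r * c)^2 + (r*s)^2 = r^2 by linear_combination r^2 * hcs,
      Real.sqrt_sq (by linarith)]
  · rw [dH_eq0, show Hmul (Hinv (x, y, 0)) (r * c, r * s, 0) = ((r-m)*c, (r-m)*s, 0) by
      clear_value m
      subst hx
      rw [hy]
      ext <;> simp [Hmul, Hinv] <;> ring]
    rw [dH_hor, show ((r-m) * c)^2 + ((r-m)*s)^2 = (r-m)^2 by linear_combination (r-m)^2 * hcs,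
      Real.sqrt_sq (by linarith)]

theorem hor_map (T : H → H) (hT : ∀ P Q : H, dH (T P) (T Q) = dH P Q) (h0 : T HO = HO) (x y : ℝ) :
    (T (x, y, 0)).2.2 = 0 := by
  have e : ∀ Q, dH HO (T Q) = dH HO Q := by
    intro Q
    have := hT HO Q
    rwa [h0] at this
  apply ext_hor
  intro r hr
  rw [e] at hr ⊢
  obtain ⟨Q', h1, h2⟩ := hor_ext x y r hr
  exact ⟨T Q', by rw [e, h1], by rw [hT, h2]⟩

open Filter Topology in
theorem bus1 (P : H) : Tendsto (fun R : ℝ => dH P (R, 0, 0) - R) atTop (𝓝 (-P.1)) := by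
  obtain ⟨x, y, t⟩ := P
  set C := |t| + 3 * |y| with hC
  have hC0 : 0 ≤ C := by positivity
  have hU : Tendsto (fun R : ℝ => -x + C^2 / R + (|y| + C)^2 / (R - 2 * x)) atTop (𝓝 (-x)) := by
    have h1 : Tendsto (fun R : ℝ => C^2 / R) atTop (𝓝 0) := tendsto_id.const_div_atTop _
    have h2 : Tendsto (fun R : ℝ => (|y| + C)^2 / (R - 2 * x)) atTop (𝓝 0) :=
      (tendsto_atTop_add_const_right _ (-(2 * x)) tendsto_id).const_div_atTop _
    simpa using (tendsto_const_nhds.add h1).add h2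
  have key : ∀ A B : ℝ, 0 < A → Real.sqrt (A^2 + B^2) ≤ A + B^2 / (2 * A) := by
    intro A B hA
    apply Real.sqrt_le_iff.2 ⟨by positivity, ?_⟩
    have : (A + B^2 / (2 * A))^2 = A^2 + B^2 + (B^2 / (2 * A))^2 := by field_simp; ring
    rw [this]; nlinarith [sq_nonneg (B^2 / (2 * A))]
  refine tendsto_of_tendsto_of_tendsto_of_le_of_le' tendsto_const_nhds hU ?_ ?_
  · refine Eventually.of_forall fun R => ?_
    have h1 := dH_proj (x, y, t) (R, 0, 0)
    have h2 : R - x ≤ Real.sqrt ((R - x)^2 + (0 - y)^2) :=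
      Real.le_sqrt_of_sq_le (by nlinarith [sq_nonneg (0-y)])
    simp only at h1 ⊢
    linarith
  · filter_upwards [eventually_ge_atTop (2 * |x| + 1)] with R hR
    have hx := le_abs_self x
    have hx0 := abs_nonneg x
    have hRx : R ≤ 2 * (R - x) := by linarith
    have hR1 : 1 ≤ R := by linarith
    have hR2 : 0 < R - 2 * x := by linarith
    set β := -(t + 3 * R * y) / (2 * (R - x)) with hβ
    have hβ1 : β * (2 * (R - x)) = -(t + 3 * R * y) := by
      rw [hβ, div_mul_cancel₀]
      linarith
    have hβC : |β| ≤ C := by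
      rw [hβ, abs_div, abs_of_pos (show 0 < 2 * (R-x) by linarith), div_le_iff₀ (by linarith), abs_neg]
      have h1 : |t + 3 * R * y| ≤ |t| + 3 * R * |y| := by
        refine (abs_add_le _ _).trans (le_of_eq ?_)
        rw [abs_mul, abs_mul, abs_of_pos (show 0 < R by linarith)]; norm_num
      have h2 : C * R ≤ C * (2 * (R - x)) := mul_le_mul_of_nonneg_left hRx hC0
      have h3 : |t| + 3 * R * |y| ≤ C * R := by
        rw [hC]; nlinarith [abs_nonneg t]
      linarith
    have s1 := dH_seg (x, y, t) (R/2) β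
    have s2 := dH_seg (Hmul (x, y, t) (R/2, β, 0)) (R/2 - x) (-(y + β))
    have e : Hmul (Hmul (x, y, t) (R/2, β, 0)) (R/2 - x, -(y + β), 0) = (R, 0, 0) := by
      ext
      · simp [Hmul]; ring
      · simp [Hmul]
      · simp [Hmul]; linear_combination hβ1
    rw [e] at s2
    have s3 := dH_tri (x, y, t) (Hmul (x, y, t) (R/2, β, 0)) (R, 0, 0)
    have k1 := key (R/2) β (by linarith)
    have k2 := key (R/2 - x) (-(y+β)) (by linarith)
    have b1 : β^2 ≤ C^2 := sq_le_sq' (by linarith [neg_abs_le β]) (by linarith [le_abs_self β])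
    have b2 : (-(y+β))^2 ≤ (|y| + C)^2 := by
      have := abs_add_le y β
      rw [neg_sq, ← sq_abs]
      exact pow_le_pow_left₀ (abs_nonneg _) (by linarith) 2
    have k3 : β^2 / (2 * (R/2)) ≤ C^2 / R := by
      rw [show 2 * (R/2) = R by ring]; gcongr
    have k4 : (-(y+β))^2 / (2 * (R/2 - x)) ≤ (|y| + C)^2 / (R - 2 * x) := by
      rw [show 2 * (R/2 - x) = R - 2 * x by ring]; gcongr
    linarith

theorem sim_iso (c s : ℝ) (h : c^2+s^2 = 1) (P Q : H) :
    dH (sim c s HO P) (sim c s HO Q) = dH P Q := by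
  have h1 := dH_sim c s HO P Q
  have h2 := dH_sim c (-s) HO (sim c s HO P) (sim c s HO Q)
  have e : ∀ P, sim c (-s) HO (sim c s HO P) = P := by
    intro P
    ext
    · simp [sim, Hmul, HO]; linear_combination P.1 * h
    · simp [sim, Hmul, HO]; linear_combination P.2.1 * h
    · simp [sim, Hmul, HO, h]
  rw [e, e] at h2
  rw [h, Real.sqrt_one, one_mul] at h1
  rw [neg_sq, h, Real.sqrt_one, one_mul] at h2
  exact le_antisymm h1 h2

open Filter Topology in
theorem bus (c s : ℝ) (h : c^2+s^2 = 1) (P : H) :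
    Tendsto (fun R : ℝ => dH P (R * c, R * s, 0) - R) atTop (𝓝 (-(c * P.1 + s * P.2.1))) := by
  have h1 := bus1 (sim c (-s) HO P)
  have e : (sim c (-s) HO P).1 = c * P.1 + s * P.2.1 := by simp [sim, Hmul, HO]
  rw [e] at h1
  refine h1.congr fun R => ?_
  rw [← sim_iso c (-s) (by rw [neg_sq, h]) P (R * c, R * s, 0)]
  congr 2
  ext
  · simp [sim, Hmul, HO]; linear_combination -R * h
  · simp [sim, Hmul, HO]; ring
  · simp [sim, Hmul, HO]

/-- image of a unit direction -/
theorem dir_map (T : H → H) (hT : ∀ P Q : H, dH (T P) (T Q) = dH P Q) (h0 : T HO = HO)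
    (c s : ℝ) (h : c^2+s^2 = 1) : ∃ u v : ℝ, T (c, s, 0) = (u, v, 0) ∧ u^2+v^2 = 1 ∧
      ∀ P : H, u * (T P).1 + v * (T P).2.1 = c * P.1 + s * P.2.1 := by
  have en : ∀ R : ℝ, 0 ≤ R → (T (R * c, R * s, 0)).1^2 + (T (R * c, R * s, 0)).2.1^2 = R^2 := by
    intro R hR
    have h1 := hT HO (R * c, R * s, 0)
    have e : T (R * c, R * s, 0) = ((T (R * c, R * s, 0)).1, (T (R * c, R * s, 0)).2.1, 0) := by
      ext <;> simp [hor_map T hT h0]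
    rw [h0, dH_hor, show (R * c)^2 + (R*s)^2 = R^2 by linear_combination R^2 * h,
      Real.sqrt_sq hR, e, dH_hor] at h1
    have h2 := congrArg (fun a => a^2) h1
    rwa [Real.sq_sqrt (by positivity)] at h2
  refine ⟨(T (c, s, 0)).1, (T (c, s, 0)).2.1, ?_, ?_, ?_⟩
  · ext <;> simp [hor_map T hT h0]
  · simpa using en 1 (by norm_num)
  · intro P
    have hn : (T (c, s, 0)).1^2 + (T (c, s, 0)).2.1^2 = 1 := by simpa using en 1 (by norm_num)
    have hR : ∀ R : ℝ, 1 ≤ R → T (R * c, R * s, 0)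
        = (R * (T (c, s, 0)).1, R * (T (c, s, 0)).2.1, 0) := by
      intro R hR
      have h1 := en R (by linarith)
      have h2 := dH_proj (T (c, s, 0)) (T (R * c, R * s, 0))
      have h3 := dH_seg (c, s, 0) ((R-1)*c) ((R-1)*s)
      rw [show Hmul (c, s, 0) ((R-1)*c, (R-1)*s, 0) = (R * c, R * s, 0) by
        ext <;> simp [Hmul] <;> ring, show ((R-1) * c)^2 + ((R-1)*s)^2 = (R-1)^2 by
        linear_combination (R-1)^2 * h, Real.sqrt_sq (by linarith)] at h3
      rw [hT] at h2
      have h4 := (Real.sqrt_le_iff.1 (h2.trans h3)).2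
      have h5 := hor_map T hT h0 (R * c) (R * s)
      generalize T (R * c, R * s, 0) = m at *
      generalize T (c, s, 0) = n at *
      have h6 : R ≤ m.1 * n.1 + m.2.1 * n.2.1 := by nlinarith
      have h7 : (m.1 - R * n.1)^2 + (m.2.1 - R * n.2.1)^2 ≤ 0 := by nlinarith
      have h8 : m.1 - R * n.1 = 0 := by
        apply pow_eq_zero_iff (two_ne_zero) |>.1
        nlinarith [sq_nonneg (m.1 - R * n.1), sq_nonneg (m.2.1 - R * n.2.1)]
      have h9 : m.2.1 - R * n.2.1 = 0 := by
        apply pow_eq_zero_iff (two_ne_zero) |>.1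
        nlinarith [sq_nonneg (m.1 - R * n.1), sq_nonneg (m.2.1 - R * n.2.1)]
      ext
      · simp only; linarith
      · simp only; linarith
      · simpa using h5
    have b1 := bus _ _ hn (T P)
    have b2 := bus c s h P
    have b3 : Filter.Tendsto (fun R : ℝ => dH P (R * c, R * s, 0) - R) Filter.atTop
        (nhds (-((T (c, s, 0)).1 * (T P).1 + (T (c, s, 0)).2.1 * (T P).2.1))) := by
      refine b1.congr' ?_
      filter_upwards [Filter.eventually_ge_atTop 1] with R h1
      rw [← hR R h1, hT]
    have := tendsto_nhds_unique b2 b3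
    linarith

theorem hor_mul (T : H → H) (hT : ∀ P Q : H, dH (T P) (T Q) = dH P Q) (P : H) (x y : ℝ) :
    (Hmul (Hinv (T P)) (T (Hmul P (x, y, 0)))).2.2 = 0 := by
  refine hor_map (fun Q => Hmul (Hinv (T P)) (T (Hmul P Q))) ?_ ?_ x y
  · intro A B
    rw [dH_left, hT, dH_left]
  · simp only [Hmul_HO, Hinv_mul]

theorem t_map (T : H → H) (hT : ∀ P Q : H, dH (T P) (T Q) = dH P Q) (h0 : T HO = HO)
    (p q r s σ : ℝ) (h : ∀ P, (T P).1 = p * P.1 + q * P.2.1 ∧ (T P).2.1 = r * P.1 + s * P.2.1)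
    (hσ : p * s - q * r = σ) (P : H) : (T P).2.2 = σ * P.2.2 := by
  have inv : ∀ (P : H) (x y : ℝ), (T P).2.2 = σ * P.2.2 →
      (T (Hmul P (x, y, 0))).2.2 = σ * (Hmul P (x, y, 0)).2.2 := by
    intro P x y hP
    have h1 := hor_mul T hT P x y
    have h2 := h P
    have h3 := h (Hmul P (x, y, 0))
    generalize T (Hmul P (x, y, 0)) = W at *
    generalize T P = V at *
    obtain ⟨v1, v2, v3⟩ := V
    obtain ⟨w1, w2, w3⟩ := W
    simp [Hmul, Hinv] at *
    obtain ⟨rfl, rfl⟩ := h2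
    obtain ⟨rfl, rfl⟩ := h3
    subst hP hσ
    linear_combination h1
  have i0 : (T HO).2.2 = σ * (HO).2.2 := by rw [h0]; simp [HO]
  have i5 := inv _ 0 (P.2.2/4) (inv _ (-1) 0 (inv _ 0 (-P.2.2/4) (inv _ 1 0 (inv _ P.1 P.2.1 i0))))
  have e : Hmul (Hmul (Hmul (Hmul (Hmul HO (P.1, P.2.1, 0)) (1, 0, 0)) (0, -P.2.2/4, 0)) (-1, 0, 0))
      (0, P.2.2/4, 0) = P := by
    ext <;> simp [Hmul, HO] <;> ring
  rwa [e] at i5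

theorem part1 (T : H → H) (hT : ∀ P Q : H, dH (T P) (T Q) = dH P Q) (h0 : T HO = HO) :
    ∃ θ : ℝ, (∀ p : H, T p = Hrot θ p) ∨ (∀ p : H, T p = Hrot θ (HJ p)) := by
  obtain ⟨a, b, e1, n1, k1⟩ := dir_map T hT h0 1 0 (by norm_num)
  obtain ⟨c, d, e2, n2, k2⟩ := dir_map T hT h0 0 1 (by norm_num)
  have o := k1 (0, 1, 0)
  rw [e2] at o
  simp at o
  obtain ⟨θ, h1, h2⟩ : ∃ θ : ℝ, Real.cos θ = a ∧ Real.sin θ = b := by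
    have hne : (⟨a, b⟩ : ℂ) ≠ 0 := by
      intro h
      have ha := congrArg Complex.re h
      have hb := congrArg Complex.im h
      simp at ha hb
      subst ha hb
      norm_num at n1
    have hn : ‖(⟨a, b⟩ : ℂ)‖ = 1 := by
      rw [Complex.norm_eq_sqrt_sq_add_sq]; simp [n1]
    refine ⟨Complex.arg ⟨a, b⟩, ?_, ?_⟩
    · rw [Complex.cos_arg hne, hn]; simp
    · rw [Complex.sin_arg, hn]; simp
  have hc : c = -b * (a * d - b * c) := by linear_combination -c * n1 + a * o
  have hd : d = a * (a * d - b * c) := by linear_combination -d * n1 + b * o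
  have hs : (a * d - b * c) * (a * d - b * c) = 1 := by
    linear_combination (c^2+d^2) * n1 + n2 - (a*c+b*d) * o
  refine ⟨θ, ?_⟩
  rcases mul_self_eq_one_iff.1 hs with h | h
  · left
    rw [h] at hc hd
    have hm : ∀ P : H, (T P).1 = a * P.1 + (-b) * P.2.1 ∧ (T P).2.1 = b * P.1 + a * P.2.1 := by
      intro P
      have p1 := k1 P
      have p2 := k2 P
      rw [hc, hd] at p2
      constructor
      · linear_combination a * p1 - b * p2 - (T P).1 * n1
      · linear_combination b * p1 + a * p2 - (T P).2.1 * n1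
    intro P
    have ht := t_map T hT h0 a (-b) b a 1 hm (by linarith) P
    ext
    · simp only [Hrot, h1, h2, (hm P).1]; ring
    · simp only [Hrot, h1, h2, (hm P).2]
    · simp only [Hrot, ht]; ring
  · right
    rw [h] at hc hd
    have hm : ∀ P : H, (T P).1 = a * P.1 + b * P.2.1 ∧ (T P).2.1 = b * P.1 + (-a) * P.2.1 := by
      intro P
      have p1 := k1 P
      have p2 := k2 P
      rw [hc, hd] at p2
      constructor
      · linear_combination a * p1 + b * p2 - (T P).1 * n1
      · linear_combination b * p1 - a * p2 - (T P).2.1 * n1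
    intro P
    have ht := t_map T hT h0 a b b (-a) (-1) hm (by linarith) P
    ext
    · simp only [Hrot, HJ, h1, h2, (hm P).1]; ring
    · simp only [Hrot, HJ, h1, h2, (hm P).2]; ring
    · simp only [Hrot, HJ, ht]; ring

/-- classification of the isometries of `ℍ`.
If `T` is a bijective isometry of `(ℍ, d)` fixing `O`, then there is `θ ∈ ℝ`
with `T = R_θ` or `T = R_θ ∘ J`; consequently every bijective isometry of
`(ℍ, d)` is the composition of a left translation, a rotation `R_θ`, and
possibly the map `J`. -/
theorem statement19 :
    (∀ T : H → H, Function.Bijective T → (∀ P Q : H, dH (T P) (T Q) = dH P Q) →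
      T HO = HO →
      ∃ θ : ℝ, (∀ p : H, T p = Hrot θ p) ∨ (∀ p : H, T p = Hrot θ (HJ p))) ∧
    (∀ T : H → H, Function.Bijective T → (∀ P Q : H, dH (T P) (T Q) = dH P Q) →
      ∃ (P₀ : H) (θ : ℝ) (m : Bool),
        ∀ p : H, T p = Hmul P₀ (Hrot θ (if m then HJ p else p))) := by

  refine ⟨fun T _ hT h0 => part1 T hT h0, fun T _ hT => ?_⟩
  obtain ⟨θ, h⟩ := part1 (fun P => Hmul (Hinv (T HO)) (T P))
    (fun P Q => by rw [dH_left, hT]) (Hinv_mul _)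
  rcases h with h | h
  · refine ⟨T HO, θ, false, fun p => ?_⟩
    rw [if_neg (by simp), ← h p, Hmul_cancel]
  · refine ⟨T HO, θ, true, fun p => ?_⟩
    rw [if_pos rfl, ← h p, Hmul_cancel]
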